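/- arXiv:1903.11892 — 2 statements merged into one kernel-verified Lean document; each statement's English description precedes it below -/
import Mathlib

section
/- Let n ≥ 3 and let W ≤ F_{q^n} be an F_q-linear hyperplane (subspace of dimension n−1). Then the norm map N : F_{q^n} → F_q is surjective on W. -/
open Classical in
theorem aux_card_units {F E : Type*} [Field F] [Fintype F] [Field E] [Fintype E] [Algebra F E]
    (V : Submodule F E) :
    (Finset.univ.filter (fun c : Eˣ => (c : E) ∈ V)).card + 1
      = Fintype.card F ^ Module.finrank F V := by
  have h1 : Nat.card V = Fintype.card F ^ Module.finrank F V := by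
    rw [Module.natCard_eq_pow_finrank (K := F), Nat.card_eq_fintype_card]
  rw [← h1, Nat.card_eq_fintype_card, Fintype.card_subtype]
  have h2 : (Finset.univ.filter (fun c : E => c ∈ V))
      = insert 0 ((Finset.univ.filter (fun c : Eˣ => (c : E) ∈ V)).image (fun c : Eˣ => (c : E))) := by
    ext c
    simp only [Finset.mem_filter, Finset.mem_univ, true_and, Finset.mem_insert, Finset.mem_image]
    constructor
    · intro h
      by_cases hc : c = 0
      · exact Or.inl hc
      · exact Or.inr ⟨Units.mk0 c hc, h, rfl⟩
    · rintro (rfl | ⟨u, hu, rfl⟩)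
      · exact V.zero_mem
      · exact hu
  rw [h2, Finset.card_insert_of_notMem, Finset.card_image_of_injective _ Units.val_injective]
  simp

/-- multipliers of `W`. -/
def auxT {F E : Type*} [Field F] [Field E] [Algebra F E] (W : Submodule F E) : Submodule F E where
  carrier := {u | ∀ w ∈ W, w * u ∈ W}
  add_mem' := by
    intro a b ha hb w hw
    rw [mul_add]; exact W.add_mem (ha w hw) (hb w hw)
  zero_mem' := by intro w _; simp
  smul_mem' := by
    intro r a ha w hw
    rw [mul_smul_comm]; exact W.smul_mem r (ha w hw)

theorem aux_finrank_T {F E : Type*} [Field F] [Fintype F] [Field E] [Fintype E] [Algebra F E]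
    (W : Submodule F E) (hn : 3 ≤ Module.finrank F E)
    (hW : Module.finrank F W = Module.finrank F E - 1) :
    Module.finrank F (auxT W) ≤ 1 := by
  have hne : ∃ e, e ∉ W := by
    by_contra! h
    have : W = ⊤ := by ext; simp [h]
    rw [this, finrank_top] at hW
    omega
  obtain ⟨e, he⟩ := hne
  have hq : Module.finrank F (E ⧸ W) = 1 := by
    have := W.finrank_quotient_add_finrank
    omega
  let φ : auxT W →ₗ[F] E ⧸ W := W.mkQ ∘ₗ (LinearMap.mulLeft F e) ∘ₗ (auxT W).subtype
  have hφ : Function.Injective φ := by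
    rw [← LinearMap.ker_eq_bot, LinearMap.ker_eq_bot']
    rintro ⟨u, hu⟩ h
    have h1 : e * u ∈ W := by simpa [φ] using h
    by_contra hne
    have hu0 : u ≠ 0 := fun h => hne (by simp [h])
    -- multiplication by u maps W into itself, hence onto
    let ψ : W →ₗ[F] W := ((LinearMap.mulRight F u) ∘ₗ W.subtype).codRestrict W
      (fun w => hu w w.2)
    have hψ : Function.Injective ψ := by
      intro a b hab
      have : (a : E) * u = b * u := congrArg Subtype.val hab
      exact Subtype.ext (mul_right_cancel₀ hu0 this)
    have hs := LinearMap.injective_iff_surjective.1 hψ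
    obtain ⟨w, hw⟩ := hs ⟨e * u, h1⟩
    have : (w : E) * u = e * u := congrArg Subtype.val hw
    have := mul_right_cancel₀ hu0 this
    exact he (this ▸ w.2)
  rw [← hq]
  exact LinearMap.finrank_le_finrank_of_injective hφ

open Classical in
theorem aux_L1 {F E : Type*} [Field F] [Fintype F] [Field E] [Fintype E] [Algebra F E]
    (W : Submodule F E) (x : Eˣ) :
    (Finset.univ.filter (fun c : Eˣ => (c : E) * x ∈ W)).card + 1
      = Fintype.card F ^ Module.finrank F W := by
  rw [← aux_card_units W]
  congr 1
  apply Finset.card_bij (fun c _ => c * x)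
  · intro c hc; simpa using hc
  · intro a _ b _ h; exact mul_right_cancel h
  · intro b hb; exact ⟨b * x⁻¹, by simpa using hb, by simp⟩

open Classical in
theorem aux_L2 {F E : Type*} [Field F] [Fintype F] [Field E] [Fintype E] [Algebra F E]
    (W : Submodule F E) (hn : 3 ≤ Module.finrank F E)
    (hW : Module.finrank F W = Module.finrank F E - 1) (x y : Eˣ) 
    (h : ((x⁻¹ * y : Eˣ) : E) ∉ auxT W) :
    (Finset.univ.filter (fun c : Eˣ => (c : E) * x ∈ W ∧ (c : E) * y ∈ W)).card + 1
      ≤ Fintype.card F ^ (Module.finrank F E - 2) := by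
  set u : E := ((x⁻¹ * y : Eˣ) : E) with hu
  let V : Submodule F E := W ⊓ W.comap (LinearMap.mulRight F u)
  have hlt : V < W := by
    refine lt_of_le_of_ne inf_le_left ?_
    intro hVW
    apply h
    intro w hw
    rw [← hVW] at hw
    exact hw.2
  have hfr := Submodule.finrank_lt_finrank_of_lt hlt
  have hV := aux_card_units V
  have hcard : (Finset.univ.filter (fun c : Eˣ => (c : E) * x ∈ W ∧ (c : E) * y ∈ W)).card
      = (Finset.univ.filter (fun c : Eˣ => (c : E) ∈ V)).card := by
    apply Finset.card_bij (fun c _ => c * x)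
    · intro c hc
      simp only [Finset.mem_filter, Finset.mem_univ, true_and] at hc ⊢
      refine ⟨by simpa using hc.1, ?_⟩
      have : ((c * x : Eˣ) : E) * u = c * y := by
        rw [hu, ← Units.val_mul, ← Units.val_mul]; congr 1; group
      change ((c * x : Eˣ) : E) * u ∈ W
      rw [this]; exact hc.2
    · intro a _ b _ h; exact mul_right_cancel h
    · intro b hb
      simp only [Finset.mem_filter, Finset.mem_univ, true_and] at hb
      refine ⟨b * x⁻¹, ?_, by simp⟩
      simp only [Finset.mem_filter, Finset.mem_univ, true_and]
      refine ⟨by simpa using hb.1, ?_⟩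
      have h2 : (b : E) * u ∈ W := hb.2
      have : ((b * x⁻¹ : Eˣ) : E) * y = b * u := by
        rw [hu, ← Units.val_mul, ← Units.val_mul]; congr 1; group
      rw [this]; exact h2
  rw [hcard, hV]
  exact Nat.pow_le_pow_right Fintype.card_pos (by omega)

open Classical in
theorem aux_core {F E : Type*} [Field F] [Fintype F] [Field E] [Fintype E] [Algebra F E]
    (W : Submodule F E) (hn : 3 ≤ Module.finrank F E)
    (hW : Module.finrank F W = Module.finrank F E - 1) (K : Subgroup Eˣ)
    (hK : ∀ k ∈ K, (k : E) ∉ W) (q d : ℝ) (hq : q = Fintype.card F) (hd : d = K.index) :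
    (q ^ (Module.finrank F E - 1) - 1) ^ 2
      ≤ (d - 1) ^ 2 * ((q - 1) ^ 2 * q ^ (Module.finrank F E - 2)) := by
  obtain ⟨m, hm⟩ : ∃ m, Module.finrank F E = m + 2 := ⟨_, (Nat.sub_add_cancel (by omega)).symm⟩
  have e1 : Module.finrank F E - 1 = m + 1 := by omega
  have e2 : Module.finrank F E - 2 = m := by omega
  rw [e1, e2]
  have hq2 : 2 ≤ q := by rw [hq]; exact_mod_cast Fintype.one_lt_card (α := F)
  let X : Finset Eˣ := Finset.univ.filter (· ∈ K)
  let M : Eˣ → Finset Eˣ := fun c => X.filter (fun x => (c : E) * x ∈ W)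
  have hXpos : 0 < X.card := Finset.card_pos.2 ⟨1, by simp [X, K.one_mem]⟩
  have hXK : X.card = Nat.card K := by
    rw [Nat.card_eq_fintype_card, Fintype.card_subtype]
  have hE : Fintype.card Eˣ + 1 = Fintype.card F ^ (m + 2) := by
    have := aux_card_units (⊤ : Submodule F E)
    rw [finrank_top, hm] at this
    simpa using this
  have hdX : d * X.card = q ^ (m + 2) - 1 := by
    have h := K.index_mul_card
    rw [← hXK, Nat.card_eq_fintype_card] at h
    have h2 : ((K.index : ℝ) * X.card + 1) = (Fintype.card F : ℝ) ^ (m + 2) := by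
      have h3 : K.index * X.card + 1 = Fintype.card F ^ (m + 2) := by rw [h, hE]
      exact_mod_cast h3
    rw [hd, hq]; linarith
  have hEr : (Fintype.card Eˣ : ℝ) = q ^ (m + 2) - 1 := by
    have : (Fintype.card Eˣ : ℝ) + 1 = q ^ (m + 2) := by rw [hq]; exact_mod_cast hE
    linarith
  -- first moment
  have hM1 : (∑ c : Eˣ, ((M c).card : ℝ)) = X.card * (q ^ (m + 1) - 1) := by
    have : ∀ x ∈ X, (∑ c : Eˣ, (if (c : E) * x ∈ W then (1 : ℝ) else 0)) = q ^ (m + 1) - 1 := by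
      intro x _
      have h := aux_L1 W x
      rw [hW, e1] at h
      rw [Finset.sum_boole, hq, eq_sub_iff_add_eq]
      exact_mod_cast h
    rw [← nsmul_eq_mul, ← Finset.sum_const, ← Finset.sum_congr rfl this, Finset.sum_comm]
    apply Finset.sum_congr rfl
    intro c _
    rw [Finset.sum_boole]
  -- second moment
  have hpair : ∀ x ∈ X, ∀ y ∈ X,
      (∑ c : Eˣ, (if (c : E) * x ∈ W ∧ (c : E) * y ∈ W then (1 : ℝ) else 0))
        ≤ (q ^ m - 1) + (if ((x⁻¹ * y : Eˣ) : E) ∈ auxT W then q ^ (m + 1) - q ^ m else 0) := by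
    intro x _ y _
    rw [Finset.sum_boole]
    split_ifs with h
    · have h1 := aux_L1 W x
      rw [hW, e1] at h1
      have h2 : (Finset.univ.filter (fun c : Eˣ => (c : E) * x ∈ W ∧ (c : E) * y ∈ W)).card
          ≤ (Finset.univ.filter (fun c : Eˣ => (c : E) * x ∈ W)).card := by
        apply Finset.card_le_card
        intro c hc
        simp only [Finset.mem_filter, Finset.mem_univ, true_and] at hc ⊢
        exact hc.1
      have h3 : ((Finset.univ.filter
          (fun c : Eˣ => (c : E) * x ∈ W ∧ (c : E) * y ∈ W)).card : ℝ) + 1 ≤ q ^ (m + 1) := by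
        rw [hq]; exact_mod_cast (Nat.succ_le_succ h2).trans h1.le
      linarith
    · have h1 := aux_L2 W hn hW x y h
      rw [e2] at h1
      have h3 : ((Finset.univ.filter
          (fun c : Eˣ => (c : E) * x ∈ W ∧ (c : E) * y ∈ W)).card : ℝ) + 1 ≤ q ^ m := by
        rw [hq]; exact_mod_cast h1
      linarith
  have hrow : ∀ x ∈ X, (∑ y ∈ X, ((q ^ m - 1) +
      (if ((x⁻¹ * y : Eˣ) : E) ∈ auxT W then q ^ (m + 1) - q ^ m else 0)))
        ≤ X.card * (q ^ m - 1) + (q - 1) ^ 2 * q ^ m := by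
    intro x _
    rw [Finset.sum_add_distrib, Finset.sum_const, nsmul_eq_mul, ← Finset.sum_filter,
      Finset.sum_const, nsmul_eq_mul]
    have h1 : (X.filter (fun y => ((x⁻¹ * y : Eˣ) : E) ∈ auxT W)).card
        ≤ (Finset.univ.filter (fun c : Eˣ => (c : E) ∈ auxT W)).card := by
      apply Finset.card_le_card_of_injOn (fun y => x⁻¹ * y)
      · intro y hy
        simp only [Finset.coe_filter, Set.mem_ofPred_eq, Finset.mem_univ, true_and] at hy ⊢
        exact hy.2
      · intro a _ b _ h; exact mul_left_cancel h
    have h2 := aux_card_units (auxT W)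
    have h3 : Fintype.card F ^ Module.finrank F (auxT W) ≤ Fintype.card F ^ 1 :=
      Nat.pow_le_pow_right Fintype.card_pos (aux_finrank_T W hn hW)
    have h4 : ((X.filter (fun y => ((x⁻¹ * y : Eˣ) : E) ∈ auxT W)).card : ℝ) + 1 ≤ q := by
      rw [hq]
      have : (X.filter (fun y => ((x⁻¹ * y : Eˣ) : E) ∈ auxT W)).card + 1 ≤ Fintype.card F := by
        rw [pow_one] at h3; omega
      exact_mod_cast this
    have h5 : 0 ≤ (q - 1) * q ^ m := by
      have : 0 ≤ q - 1 := by linarith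
      positivity
    have h6 := mul_le_mul_of_nonneg_right (le_sub_iff_add_le.2 h4) h5
    have h7 : q ^ (m + 1) - q ^ m = (q - 1) * q ^ m := by ring
    rw [h7]
    nlinarith
  have hM2 : (∑ c : Eˣ, ((M c).card : ℝ) ^ 2)
      ≤ X.card * (X.card * (q ^ m - 1) + (q - 1) ^ 2 * q ^ m) := by
    have : ∀ c : Eˣ, ((M c).card : ℝ) ^ 2 = ∑ x ∈ X, ∑ y ∈ X,
        (if (c : E) * x ∈ W ∧ (c : E) * y ∈ W then (1 : ℝ) else 0) := by
      intro c
      have h : ((M c).card : ℝ) = ∑ x ∈ X, (if (c : E) * x ∈ W then (1 : ℝ) else 0) := by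
        rw [Finset.sum_boole]
      rw [h, sq, Finset.sum_mul_sum]
      refine Finset.sum_congr rfl fun x _ => Finset.sum_congr rfl fun y _ => ?_
      by_cases h1 : (c : E) * x ∈ W <;> by_cases h2 : (c : E) * y ∈ W <;> simp [h1, h2]
    simp_rw [this]
    rw [Finset.sum_comm, ← nsmul_eq_mul, ← Finset.sum_const]
    apply Finset.sum_le_sum
    intro x hx
    rw [Finset.sum_comm]
    exact (Finset.sum_le_sum fun y hy => hpair x hx y hy).trans (hrow x hx)
  -- Cauchy-Schwarz off K
  have hz : ∀ c ∈ X, (M c).card = 0 := by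
    intro c hc
    rw [Finset.card_eq_zero, Finset.filter_eq_empty_iff]
    intro x hx hmem
    have hc' : c ∈ K := by simpa [X] using hc
    have hx' : x ∈ K := by simpa [X] using hx
    exact hK _ (K.mul_mem hc' hx') (by simpa using hmem)
  have hs1 : (∑ c ∈ Xᶜ, ((M c).card : ℝ)) = ∑ c : Eˣ, ((M c).card : ℝ) := by
    rw [← Finset.sum_add_sum_compl X, Finset.sum_eq_zero (s := X), zero_add]
    intro c hc; simp [hz c hc]
  have hs2 : (∑ c ∈ Xᶜ, ((M c).card : ℝ) ^ 2) ≤ ∑ c : Eˣ, ((M c).card : ℝ) ^ 2 :=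
    Finset.sum_le_sum_of_subset_of_nonneg (Finset.subset_univ _) (fun _ _ _ => sq_nonneg _)
  have hcs := sq_sum_le_card_mul_sum_sq (s := Xᶜ) (f := fun c => ((M c).card : ℝ))
  have hcomp : ((Xᶜ).card : ℝ) = (d - 1) * X.card := by
    have : (X.card : ℝ) + (Xᶜ).card = Fintype.card Eˣ := by
      exact_mod_cast Finset.card_add_card_compl X
    rw [hEr, ← hdX] at this
    linarith
  have hc0 : (0 : ℝ) ≤ (Xᶜ).card := Nat.cast_nonneg _
  rw [hs1, hM1] at hcs
  have hcs2 := hcs.trans (mul_le_mul_of_nonneg_left (hs2.trans hM2) hc0)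
  rw [hcomp] at hcs2
  have hXr : (0 : ℝ) < X.card := by exact_mod_cast hXpos
  generalize (X.card : ℝ) = x at *
  have hd0 : 0 < d := by
    by_contra! h
    have : (1 : ℝ) < q ^ (m + 2) := one_lt_pow₀ (by linarith) (by omega)
    nlinarith
  have h1 : (q ^ (m + 1) - 1) ^ 2 ≤ (d - 1) * (x * (q ^ m - 1) + (q - 1) ^ 2 * q ^ m) := by
    have : x ^ 2 * (q ^ (m + 1) - 1) ^ 2
        ≤ x ^ 2 * ((d - 1) * (x * (q ^ m - 1) + (q - 1) ^ 2 * q ^ m)) := by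
      nlinarith
    exact le_of_mul_le_mul_left this (by positivity)
  have h2 := mul_le_mul_of_nonneg_left h1 hd0.le
  have h3 : d * ((d - 1) * (x * (q ^ m - 1) + (q - 1) ^ 2 * q ^ m))
      = (d - 1) * ((d * x) * (q ^ m - 1) + d * ((q - 1) ^ 2 * q ^ m)) := by ring
  have h4 : (d * x) * (q ^ m - 1) = (q ^ (m + 1) - 1) ^ 2 - (q - 1) ^ 2 * q ^ m := by
    rw [hdX]; ring
  rw [h3, h4] at h2
  nlinarith

theorem norm_surjective_on_hyperplane
    (F E : Type*) [Field F] [Fintype F] [Field E] [Fintype E] [Algebra F E]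
    (hn : 3 ≤ Module.finrank F E)
    (W : Submodule F E)
    (hW : Module.finrank F W = Module.finrank F E - 1) :
    ∀ a : F, ∃ x ∈ W, Algebra.norm F x = a := by
  classical
  intro a
  have : Module.Finite F E := Module.finite_of_finrank_pos (by omega)
  by_cases ha : a = 0
  · refine ⟨0, W.zero_mem, ?_⟩
    rw [ha]; exact Algebra.norm_zero
  by_contra! hno
  have hsurj : Function.Surjective (Units.map (Algebra.norm F : E →* F)) :=
    FiniteField.unitsMap_norm_surjective F E
  obtain ⟨g, hg⟩ := hsurj (Units.mk0 a ha)
  have hg' : Algebra.norm F (g : E) = a := congrArg Units.val hg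
  set n := Module.finrank F E with hndef
  let H : Subgroup Fˣ := (powMonoidHom n : Fˣ →* Fˣ).range
  let K : Subgroup Eˣ := H.comap (Units.map (Algebra.norm F : E →* F))
  have hidx : K.index = (Nat.card Fˣ).gcd n := by
    rw [Subgroup.index_comap_of_surjective _ hsurj]
    exact IsCyclic.index_powMonoidHom_range ..
  let W' : Submodule F E := W.comap (LinearMap.mulLeft F (g : E))
  have hW' : Module.finrank F W' = Module.finrank F E - 1 := by
    rw [← hndef, ← hW]
    have h1 := aux_L1 W g
    have h2 := aux_card_units W'
    have h3 : (Finset.univ.filter (fun c : Eˣ => (c : E) * g ∈ W))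
        = Finset.univ.filter (fun c : Eˣ => (c : E) ∈ W') := by
      ext c
      simp [W', mul_comm]
    have h4 : Fintype.card F ^ Module.finrank F W' = Fintype.card F ^ Module.finrank F W := by
      rw [← h1, ← h2, ← h3]
    exact Nat.pow_right_injective (Fintype.one_lt_card (α := F)) h4
  have hK : ∀ k ∈ K, (k : E) ∉ W' := by
    rintro k ⟨t, ht⟩ hk
    have ht' : (t : F) ^ n = Algebra.norm F (k : E) := congrArg Units.val ht
    have hk' : (g : E) * k ∈ W := hk
    refine hno (((t⁻¹ : Fˣ) : F) • ((g : E) * k)) (W.smul_mem _ hk') ?_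
    rw [Algebra.smul_def, map_mul, map_mul, Algebra.norm_algebraMap, hg', ← ht', ← hndef]
    rw [mul_comm a, ← mul_assoc, ← mul_pow]
    simp
  have hcore := aux_core W' hn hW' K hK _ _ rfl rfl
  rw [hidx, ← hndef] at hcore
  have hq : 2 ≤ Fintype.card F := Fintype.one_lt_card (α := F)
  have hFu : Nat.card Fˣ + 1 = Fintype.card F := by
    rw [Nat.card_eq_fintype_card, Fintype.card_units]; omega
  have hd1 : (Nat.card Fˣ).gcd n ≤ n := Nat.gcd_le_right _ (by omega)
  have hd2 : (Nat.card Fˣ).gcd n + 1 ≤ Fintype.card F := by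
    have := Nat.gcd_le_left n (m := Nat.card Fˣ) (by omega)
    omega
  have hd0 : 1 ≤ (Nat.card Fˣ).gcd n := Nat.gcd_pos_of_pos_right _ (by omega)
  generalize (Nat.card Fˣ).gcd n = d at *
  clear_value n
  have hqr : (2 : ℝ) ≤ Fintype.card F := by exact_mod_cast hq
  have hd1r : (d : ℝ) ≤ n := by exact_mod_cast hd1
  have hd2r : (d : ℝ) + 1 ≤ Fintype.card F := by exact_mod_cast hd2
  have hd0r : (1 : ℝ) ≤ d := by exact_mod_cast hd0
  generalize (Fintype.card F : ℝ) = q at *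
  rcases Nat.lt_or_ge 3 n with h | h
  · obtain ⟨m, rfl⟩ : ∃ m, n = m + 4 := ⟨n - 4, by omega⟩
    have e1 : m + 4 - 1 = m + 3 := by omega
    have e2 : m + 4 - 2 = m + 2 := by omega
    rw [e1, e2] at hcore
    have hqm : 1 ≤ q ^ m := one_le_pow₀ (by linarith)
    have hqm2 : 1 ≤ q ^ (m + 2) := one_le_pow₀ (by linarith)
    have h1 : (q - 1) * q ^ (m + 2) ≤ q ^ (m + 3) - 1 := by
      have : q ^ (m + 3) = q * q ^ (m + 2) := by ring
      nlinarith
    have h2 : ((q - 1) * q ^ (m + 2)) ^ 2 ≤ (q ^ (m + 3) - 1) ^ 2 :=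
      pow_le_pow_left₀ (mul_nonneg (by linarith) (by linarith)) h1 2
    have h3 := h2.trans hcore
    have h4 : ((q - 1) ^ 2 * q ^ (m + 2)) * q ^ (m + 2)
        ≤ ((q - 1) ^ 2 * q ^ (m + 2)) * (d - 1) ^ 2 := by linarith
    have hpos : 0 < (q - 1) ^ 2 * q ^ (m + 2) :=
      mul_pos (pow_pos (by linarith) 2) (by linarith)
    have h5 := le_of_mul_le_mul_left h4 hpos
    have h6 : q ^ 2 ≤ q ^ (m + 2) := by
      rw [pow_add]; nlinarith [sq_nonneg q]
    nlinarith
  · obtain rfl : n = 3 := by omega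
    norm_num at hcore
    have hd1r : (d : ℝ) ≤ 3 := by exact_mod_cast hd1
    have h1 : (d - 1 : ℝ) ^ 2 ≤ 4 := by nlinarith
    have h2 : (q - 1) ^ 2 * (q + 1) ^ 2 ≤ (q - 1) ^ 2 * (4 * q) := by
      have : (d - 1 : ℝ) ^ 2 * ((q - 1) ^ 2 * q) ≤ 4 * ((q - 1) ^ 2 * q) :=
        mul_le_mul_of_nonneg_right h1 (mul_nonneg (sq_nonneg _) (by linarith))
      nlinarith
    have h3 := le_of_mul_le_mul_left h2 (pow_pos (by linarith) 2)
    nlinarith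
end

section
/- The number of elements of GL(n, q) of the form: irreducible of order (q^n − 1)/(q − 1), equals |GL(n,q)| · φ((q^n−1)/(q−1)) / (n·(q^n − 1)), where φ is Euler's totient function. Equivalently, the proportion of such elements in GL(n,q) is φ((q^n−1)/(q−1)) / (n·(q^n−1)). -/
open Polynomial IntermediateField

namespace SingerCount

variable {F V K : Type*} [Field F] [AddCommGroup V] [Module F V] [Field K] [Algebra F K]

/-- No proper nonzero invariant subspaces. -/
def Irr (g : Module.End F V) : Prop :=
  ∀ W : Submodule F V, (∀ v ∈ W, g v ∈ W) → W = ⊥ ∨ W = ⊤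

lemma irr_mul [FiniteDimensional F K] {x : K} (hx : F⟮x⟯ = ⊤) (W : Submodule F K)
    (hW : ∀ v ∈ W, x * v ∈ W) : W = ⊥ ∨ W = ⊤ := by
  have hall : ∀ a v : K, v ∈ W → a * v ∈ W := by
    intro a
    have ha : a ∈ Algebra.adjoin F {x} := by
      rw [(IntermediateField.adjoin_eq_top_iff).1 hx]; trivial
    induction ha using Algebra.adjoin_induction with
    | mem y hy => rw [Set.mem_singleton_iff.1 hy]; exact hW
    | algebraMap r => intro v hv; rw [← Algebra.smul_def]; exact W.smul_mem r hv
    | add a b _ _ ha hb => intro v hv; rw [add_mul]; exact W.add_mem (ha v hv) (hb v hv)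
    | mul a b _ _ ha hb => intro v hv; rw [mul_assoc]; exact ha _ (hb v hv)
  by_cases h : W = ⊥
  · exact Or.inl h
  · right
    obtain ⟨w, hw, hw0⟩ := Submodule.exists_mem_ne_zero_of_ne_bot h
    rw [eq_top_iff]
    intro a _
    have := hall (a * w⁻¹) w hw
    rwa [mul_assoc, inv_mul_cancel₀ hw0, mul_one] at this

lemma adjoin_top [Finite F] [FiniteDimensional F K] {x : K} (hn : 0 < Module.finrank F K)
    (hx : orderOf x = (Nat.card F ^ Module.finrank F K - 1) / (Nat.card F - 1)) : F⟮x⟯ = ⊤ := by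
  have hq : 2 ≤ Nat.card F := Finite.one_lt_card
  set q := Nat.card F
  set n := Module.finrank F K with hndef
  rw [← Nat.geomSum_eq hq] at hx
  by_contra hne
  have hlt : Module.finrank F F⟮x⟯ < n := by
    have hle : Module.finrank F F⟮x⟯ ≤ n := Submodule.finrank_le (F⟮x⟯.toSubalgebra.toSubmodule)
    refine lt_of_le_of_ne hle fun h => hne ?_
    exact IntermediateField.eq_of_le_of_finrank_eq le_top (by rw [h, IntermediateField.finrank_top'])
  have hpos : 0 < orderOf x := by
    rw [hx]
    exact Finset.sum_pos (fun i _ => by positivity) ⟨0, by simpa using hn⟩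
  have hx0 : x ≠ 0 := by
    rintro rfl
    have := pow_orderOf_eq_one (0 : K)
    rw [zero_pow hpos.ne'] at this
    exact zero_ne_one this
  have hfin : Finite F⟮x⟯ := Module.finite_of_finite F
  let y : F⟮x⟯ := AdjoinSimple.gen F x
  have hy0 : y ≠ 0 := by
    intro h
    apply hx0
    have := congrArg (algebraMap F⟮x⟯ K) h
    simpa [y] using this
  have hy : y ^ (Nat.card F⟮x⟯ - 1) = 1 := by
    have := Fintype.ofFinite F⟮x⟯
    rw [Nat.card_eq_fintype_card]
    exact FiniteField.pow_card_sub_one_eq_one y hy0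
  have hx1 : x ^ (q ^ Module.finrank F F⟮x⟯ - 1) = 1 := by
    rw [← Module.natCard_eq_pow_finrank]
    have := congrArg (algebraMap F⟮x⟯ K) hy
    simpa [y] using this
  have hd : 0 < Module.finrank F F⟮x⟯ := Module.finrank_pos
  have hpow : 1 < q ^ Module.finrank F F⟮x⟯ := Nat.one_lt_pow hd.ne' hq
  have hle := Nat.le_of_dvd (by omega) (orderOf_dvd_of_pow_eq_one hx1)
  have h2 : q ^ (n - 1) ≤ orderOf x := by
    rw [hx]
    exact Finset.single_le_sum (f := fun i => q ^ i) (fun i _ => Nat.zero_le _)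
      (Finset.mem_range.2 (by omega))
  have h3 : q ^ Module.finrank F F⟮x⟯ ≤ q ^ (n - 1) := Nat.pow_le_pow_right (by omega) (by omega)
  omega

lemma comm_aeval (g : Module.End F V) (f : F[X]) (v : V) :
    aeval g f (g v) = g (aeval g f v) := by
  have : aeval g f * g = g * aeval g f := by
    have h1 : aeval g (f * X) = aeval g (X * f) := by rw [mul_comm]
    simpa using h1
  exact LinearMap.congr_fun this v

lemma aeval_eq_zero {g : Module.End F V} (hg : Irr g) {f : F[X]} {v : V} (hv : v ≠ 0)
    (h : aeval g f v = 0) : aeval g f = 0 := by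
  rcases hg (LinearMap.ker (aeval g f)) (by
    intro w hw
    rw [LinearMap.mem_ker] at hw ⊢
    rw [comm_aeval, hw, map_zero]) with h' | h'
  · exact absurd ((Submodule.eq_bot_iff _).1 h' v h) hv
  · exact LinearMap.ker_eq_top.1 h'

lemma minpoly_irreducible [FiniteDimensional F V] [Nontrivial V] {g : Module.End F V}
    (hg : Irr g) : Irreducible (minpoly F g) := by
  have hint : IsIntegral F g := Algebra.IsIntegral.isIntegral g
  rw [(minpoly.monic hint).irreducible_iff_natDegree']
  refine ⟨minpoly.ne_one F g, ?_⟩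
  intro a b ha hb hab hmem
  rw [Finset.mem_Ioc] at hmem
  have h0 : aeval g a * aeval g b = 0 := by rw [← map_mul, hab, minpoly.aeval]
  have hda : a.natDegree + b.natDegree = (minpoly F g).natDegree := by
    rw [← hab, ha.natDegree_mul hb]
  by_cases hbz : aeval g b = 0
  · have := natDegree_le_of_dvd (minpoly.dvd F g hbz) hb.ne_zero
    omega
  · obtain ⟨v, hv⟩ : ∃ v, aeval g b v ≠ 0 := by
      by_contra! h
      exact hbz (LinearMap.ext h)
    have := aeval_eq_zero hg hv (LinearMap.congr_fun h0 v)
    have := natDegree_le_of_dvd (minpoly.dvd F g this) ha.ne_zero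
    omega

/-- evaluation at a vector -/
noncomputable def ev (g : Module.End F V) (v : V) : F[X] →ₗ[F] V :=
  (LinearMap.applyₗ v) ∘ₗ (aeval g).toLinearMap

lemma ev_apply (g : Module.End F V) (v : V) (f : F[X]) : ev g v f = aeval g f v := rfl

lemma ker_ev {g : Module.End F V} (hg : Irr g) {v : V} (hv : v ≠ 0) :
    LinearMap.ker (ev g v) = (Ideal.span {minpoly F g}).restrictScalars F := by
  ext f
  rw [LinearMap.mem_ker, ev_apply, Submodule.restrictScalars_mem, Ideal.mem_span_singleton]
  constructor
  · intro h
    exact minpoly.dvd F g (aeval_eq_zero hg hv h)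
  · rintro ⟨c, rfl⟩
    simp

lemma ev_surj {g : Module.End F V} (hg : Irr g) {v : V} (hv : v ≠ 0) :
    Function.Surjective (ev g v) := by
  rw [← LinearMap.range_eq_top]
  rcases hg (LinearMap.range (ev g v)) (by
    rintro _ ⟨f, rfl⟩
    exact ⟨X * f, by simp [ev_apply]⟩) with h | h
  · exfalso
    apply hv
    have : ev g v 1 ∈ LinearMap.range (ev g v) := ⟨1, rfl⟩
    rw [h] at this
    simpa [ev_apply] using this
  · exact h

lemma natDegree_minpoly [FiniteDimensional F V] [Nontrivial V] {g : Module.End F V}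
    (hg : Irr g) : (minpoly F g).natDegree = Module.finrank F V := by
  obtain ⟨v, hv⟩ := exists_ne (0 : V)
  rw [← finrank_quotient_span_eq_natDegree]
  have e := (ev g v).quotKerEquivOfSurjective (ev_surj hg hv)
  rw [ker_ev hg hv] at e
  exact e.finrank_eq

lemma exists_root [Finite F] [FiniteDimensional F K] {p : F[X]} (hp : Irreducible p)
    (hd : p.natDegree = Module.finrank F K) : ∃ x : K, aeval x p = 0 := by
  have : Fact (Irreducible p) := ⟨hp⟩
  have hfr : Module.finrank F (AdjoinRoot p) = Module.finrank F K := by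
    rw [← hd]; exact finrank_quotient_span_eq_natDegree
  have : FiniteDimensional F (AdjoinRoot p) := (AdjoinRoot.powerBasis hp.ne_zero).finite
  have : Finite (AdjoinRoot p) := Module.finite_of_finite F
  have : Finite K := Module.finite_of_finite F
  obtain ⟨φ⟩ := FiniteField.nonempty_algHom_of_finrank_dvd (F := F) (K := AdjoinRoot p) (L := K)
    (by rw [hfr])
  refine ⟨φ (AdjoinRoot.root p), ?_⟩
  rw [aeval_algHom_apply]
  simp

lemma card_roots [Finite F] [FiniteDimensional F K] {p : F[X]} (hp : Irreducible p)
    (hm : p.Monic) (hd : p.natDegree = Module.finrank F K) :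
    Nat.card {x : K // aeval x p = 0} = Module.finrank F K := by
  obtain ⟨x, hx⟩ := exists_root hp hd
  have hmin : minpoly F x = p := (minpoly.eq_of_irreducible_of_monic hp hx hm).symm
  have : Finite K := Module.finite_of_finite F
  have hs : (p.map (algebraMap F K)).Splits := by
    rw [← hmin]
    exact Normal.splits inferInstance x
  have hc := card_rootSet_eq_natDegree (K := K) (PerfectField.separable_of_irreducible hp) hs
  rw [← hd, ← hc, ← Nat.card_eq_fintype_card]
  refine Nat.card_congr (Equiv.subtypeEquivRight fun y => ?_)
  rw [mem_rootSet]
  simp [hp.ne_zero]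

lemma exists_equiv [FiniteDimensional F K] [FiniteDimensional F V] [Nontrivial V]
    {g : Module.End F V}
    (hg : Irr g) (hVK : Module.finrank F K = Module.finrank F V) {v : V} (hv : v ≠ 0) {x : K}
    (hx : aeval x (minpoly F g) = 0) :
    F⟮x⟯ = ⊤ ∧ ∃ e : K ≃ₗ[F] V, e 1 = v ∧ ∀ a, e (x * a) = g (e a) := by
  have hirr := minpoly_irreducible hg
  have hmin : minpoly F g = minpoly F x := minpoly.eq_of_irreducible_of_monic hirr hx
    (minpoly.monic (Algebra.IsIntegral.isIntegral g))
  have htop : F⟮x⟯ = ⊤ := by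
    refine IntermediateField.eq_of_le_of_finrank_eq le_top ?_
    rw [IntermediateField.finrank_top', hVK, ← natDegree_minpoly hg, hmin,
      IntermediateField.adjoin.finrank (Algebra.IsIntegral.isIntegral x)]
  refine ⟨htop, ?_⟩
  have hsurj : Function.Surjective (aeval (R := F) x) := by
    rw [← AlgHom.range_eq_top, ← Algebra.adjoin_singleton_eq_range_aeval]
    exact (IntermediateField.adjoin_eq_top_iff).1 htop
  have hker : LinearMap.ker (aeval (R := F) x).toLinearMap = LinearMap.ker (ev g v) := by
    rw [ker_ev hg hv]
    ext f
    rw [LinearMap.mem_ker, Submodule.restrictScalars_mem, Ideal.mem_span_singleton, hmin,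
      minpoly.dvd_iff]
    rfl
  let e1 := (aeval (R := F) x).toLinearMap.quotKerEquivOfSurjective hsurj
  let e2 := (ev g v).quotKerEquivOfSurjective (ev_surj hg hv)
  let e := e1.symm ≪≫ₗ (Submodule.quotEquivOfEq _ _ hker) ≪≫ₗ e2
  have he : ∀ f : F[X], e (aeval x f) = aeval g f v := by
    intro f
    have h1 : e1.symm (aeval x f) = Submodule.Quotient.mk f := by
      rw [LinearEquiv.symm_apply_eq]; rfl
    simp only [e, LinearEquiv.trans_apply, h1]
    rfl
  refine ⟨e, by simpa using he 1, fun a => ?_⟩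
  obtain ⟨f, rfl⟩ := hsurj a
  have := he (X * f)
  rw [he]
  simpa using this

lemma orderOf_conj {g : V ≃ₗ[F] V} {x : K} (e : K ≃ₗ[F] V) (h : ∀ a, e (x * a) = g (e a)) :
    orderOf g = orderOf x := by
  have hp : ∀ k : ℕ, ∀ a, e (x ^ k * a) = (g ^ k) (e a) := by
    intro k
    induction k with
    | zero => simp
    | succ k ih =>
      intro a
      rw [pow_succ', mul_assoc, h, ih, pow_succ']; rfl
  refine orderOf_eq_orderOf_iff.2 fun k => ?_
  constructor
  · intro hk
    have := hp k 1
    rw [hk] at this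
    simpa using e.injective this
  · intro hk
    ext v
    have := hp k (e.symm v)
    rw [hk] at this
    simpa using this.symm

/-- Conjugate of multiplication by `x`. -/
noncomputable def conjMul (e : K ≃ₗ[F] V) (x : Kˣ) : V ≃ₗ[F] V :=
  e.symm ≪≫ₗ (LinearEquiv.smulOfUnit x).restrictScalars F ≪≫ₗ e

lemma conjMul_apply (e : K ≃ₗ[F] V) (x : Kˣ) (a : K) : conjMul e x (e a) = e (x * a) := by
  simp [conjMul, LinearEquiv.smulOfUnit, Units.smul_def]

lemma irr_conjMul [FiniteDimensional F K] (e : K ≃ₗ[F] V) {x : Kˣ} (hx : F⟮(x : K)⟯ = ⊤) :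
    Irr (conjMul e x : Module.End F V) := by
  intro W hW
  rcases irr_mul hx (W.comap (e : K →ₗ[F] V)) (by
    intro a ha
    have := hW _ ha
    simpa [conjMul_apply] using this) with h | h
  · left
    rw [Submodule.eq_bot_iff] at h ⊢
    intro w hw
    have := h (e.symm w) (by simpa using hw)
    simpa using this
  · right
    rw [eq_top_iff]
    intro w _
    have : e.symm w ∈ W.comap (e : K →ₗ[F] V) := by rw [h]; trivial
    simpa using this

lemma minpoly_root [FiniteDimensional F K] (e : K ≃ₗ[F] V) (x : Kˣ) :
    aeval (x : K) (minpoly F (conjMul e x : Module.End F V)) = 0 := by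
  have hp : ∀ (f : F[X]) (a : K),
      aeval (conjMul e x : Module.End F V) f (e a) = e (aeval (x : K) f * a) := by
    intro f
    induction f using Polynomial.induction_on' with
    | add p q hp hq => intro a; simp [hp, hq, add_mul]
    | monomial k c =>
      intro a
      have : ∀ k : ℕ, ((conjMul e x : Module.End F V) ^ k) (e a) = e ((x : K) ^ k * a) := by
        intro k
        induction k with
        | zero => simp
        | succ k ih =>
          rw [pow_succ', Module.End.mul_apply, ih, pow_succ', mul_assoc]
          exact conjMul_apply e x _
      rw [aeval_monomial, aeval_monomial, Module.End.mul_apply, this, mul_assoc,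
        Module.algebraMap_end_apply, ← Algebra.smul_def, map_smul]
  have := hp (minpoly F (conjMul e x : Module.End F V)) 1
  rw [minpoly.aeval] at this
  simpa using this.symm

theorem count_aux [Finite F] [FiniteDimensional F K] [FiniteDimensional F V] [Nontrivial V]
    (hVK : Module.finrank F K = Module.finrank F V) (N : ℕ)
    (hN : N = (Nat.card F ^ Module.finrank F K - 1) / (Nat.card F - 1)) :
    Nat.card (K ≃ₗ[F] V) * Nat.card {x : Kˣ // orderOf x = N} =
    Nat.card {g : V ≃ₗ[F] V // Irr (g : Module.End F V) ∧ orderOf g = N} *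
      ((Nat.card V - 1) * Module.finrank F K) := by
  have hpos : 0 < Module.finrank F K := by rw [hVK]; exact Module.finrank_pos
  have hfV : Finite V := Module.finite_of_finite F
  have hfK : Finite K := Module.finite_of_finite F
  have htop : ∀ x : Kˣ, orderOf x = N → F⟮(x : K)⟯ = ⊤ := fun x hx =>
    adjoin_top hpos (by rw [orderOf_units, hx, hN])
  let Φ : (K ≃ₗ[F] V) × {x : Kˣ // orderOf x = N} →
      Σ g : {g : V ≃ₗ[F] V // Irr (g : Module.End F V) ∧ orderOf g = N},
        {v : V // v ≠ 0} × {x : K // aeval x (minpoly F (g.1 : Module.End F V)) = 0} :=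
    fun t => ⟨⟨conjMul t.1 t.2.1, irr_conjMul t.1 (htop _ t.2.2), by
      rw [orderOf_conj (x := (t.2.1 : K)) t.1 fun a => (conjMul_apply _ _ _).symm,
        orderOf_units, t.2.2]⟩, ⟨t.1 1, by simp⟩, ⟨t.2.1, minpoly_root _ _⟩⟩
  have hinj : Function.Injective Φ := by
    rintro ⟨e, x, hx⟩ ⟨e', x', hx'⟩ h
    have h1 : conjMul e x = conjMul e' x' := congrArg (fun s => s.1.1) h
    have h2 : e 1 = e' 1 := congrArg (fun s => (s.2.1 : V)) h
    have h3 : (x : K) = x' := congrArg (fun s => (s.2.2 : K)) h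
    have h3' : x = x' := Units.ext h3
    subst h3'
    have : e = e' := by
      rcases irr_mul (htop x hx) (LinearMap.eqLocus (e : K →ₗ[F] V) (e' : K →ₗ[F] V)) (by
        intro a ha
        have ha' : e a = e' a := ha
        change e (x * a) = e' (x * a)
        rw [← conjMul_apply, ← conjMul_apply, h1, ha']) with h | h
      · have : (1 : K) ∈ LinearMap.eqLocus (e : K →ₗ[F] V) (e' : K →ₗ[F] V) := h2
        rw [h] at this
        exact absurd this (by simp)
      · ext a
        have : a ∈ LinearMap.eqLocus (e : K →ₗ[F] V) (e' : K →ₗ[F] V) := by rw [h]; trivial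
        exact this
    subst this
    rfl
  have hsurj : Function.Surjective Φ := by
    rintro ⟨⟨g, hg, ho⟩, ⟨v, hv⟩, ⟨x, hx⟩⟩
    obtain ⟨-, e, he1, he⟩ := exists_equiv hg hVK hv hx
    have hx0 : x ≠ 0 := by
      rintro rfl
      have := he 1
      rw [zero_mul, map_zero, he1] at this
      exact hv (g.map_eq_zero_iff.1 this.symm)
    have hox : orderOf (Units.mk0 x hx0) = N := by
      rw [← orderOf_units, Units.val_mk0, ← orderOf_conj (g := g) e he, ho]
    have hc : conjMul e (Units.mk0 x hx0) = g := by
      ext w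
      obtain ⟨a, rfl⟩ := e.surjective w
      rw [conjMul_apply]
      exact he a
    refine ⟨(e, ⟨Units.mk0 x hx0, hox⟩), ?_⟩
    subst hc
    subst he1
    rfl
  have hfg : Finite (V ≃ₗ[F] V) := Finite.of_injective (fun e => (e : V → V)) DFunLike.coe_injective
  have hcard := Nat.card_congr (Equiv.ofBijective Φ ⟨hinj, hsurj⟩)
  rw [Nat.card_prod] at hcard
  rw [hcard]
  have := Fintype.ofFinite {g : V ≃ₗ[F] V // Irr (g : Module.End F V) ∧ orderOf g = N}
  rw [Nat.card_sigma]
  have hv : Nat.card {v : V // v ≠ 0} = Nat.card V - 1 := by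
    classical
    have := Fintype.ofFinite V
    rw [Nat.card_eq_fintype_card, Nat.card_eq_fintype_card]
    exact Set.card_ne_eq 0
  rw [Finset.sum_congr rfl (g := fun _ => (Nat.card V - 1) * Module.finrank F K)]
  · simp [Nat.card_eq_fintype_card]
  · rintro ⟨g, hg, ho⟩ -
    rw [Nat.card_prod, hv, card_roots (minpoly_irreducible hg)
      (minpoly.monic (Algebra.IsIntegral.isIntegral _)) (by rw [natDegree_minpoly hg, hVK])]

end SingerCount

theorem count_irreducible_singer_elements
    (F : Type*) [Field F] [Fintype F] (n : ℕ) (hn : 0 < n)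
    (q : ℕ) (hq : Fintype.card F = q) :
    (Nat.card {g : GL (Fin n) F //
        (∀ W : Submodule F (Fin n → F),
          (∀ v ∈ W, (g : Matrix (Fin n) (Fin n) F).mulVec v ∈ W) → W = ⊥ ∨ W = ⊤) ∧
        orderOf g = (q ^ n - 1) / (q - 1)} : ℚ) =
      (Nat.card (GL (Fin n) F) : ℚ) * (Nat.totient ((q ^ n - 1) / (q - 1)) : ℚ) /
        ((n : ℚ) * ((q : ℚ) ^ n - 1)) := by
  obtain ⟨p, hp⟩ := CharP.exists F
  have hpp : Fact p.Prime := ⟨CharP.char_is_prime F p⟩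
  have : NeZero n := ⟨hn.ne'⟩
  let K := FiniteField.Extension F p n
  have hK : Module.finrank F K = n := FiniteField.finrank_extension F p n
  have hV : Module.finrank F (Fin n → F) = n := by simp
  have hF : Nat.card F = q := by rw [Nat.card_eq_fintype_card, hq]
  have hq2 : 2 ≤ q := by rw [← hF]; exact Finite.one_lt_card
  have : Nontrivial (Fin n → F) := inferInstance
  have : Finite K := Module.finite_of_finite F
  set N := (q ^ n - 1) / (q - 1) with hN
  have main := SingerCount.count_aux (F := F) (K := K) (V := Fin n → F) (hK.trans hV.symm) N
    (by rw [hF, hK])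
  have hcV : Nat.card (Fin n → F) = q ^ n := by
    rw [Module.natCard_eq_pow_finrank (K := F), hF, hV]
  have hcK : Nat.card K = q ^ n := by
    rw [Module.natCard_eq_pow_finrank (K := F), hF, hK]
  let Ψ : GL (Fin n) F ≃* ((Fin n → F) ≃ₗ[F] (Fin n → F)) :=
    Matrix.GeneralLinearGroup.toLin.trans (LinearMap.GeneralLinearGroup.generalLinearEquiv F _)
  have hΨ : ∀ g v, Ψ g v = (g : Matrix (Fin n) (Fin n) F).mulVec v := fun g v => rfl
  have hS : Nat.card {g : GL (Fin n) F //
        (∀ W : Submodule F (Fin n → F),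
          (∀ v ∈ W, (g : Matrix (Fin n) (Fin n) F).mulVec v ∈ W) → W = ⊥ ∨ W = ⊤) ∧
        orderOf g = N} = Nat.card {g : (Fin n → F) ≃ₗ[F] (Fin n → F) //
          SingerCount.Irr (g : Module.End F (Fin n → F)) ∧ orderOf g = N} := by
    refine Nat.card_congr (Equiv.subtypeEquiv Ψ.toEquiv fun g => ?_)
    refine and_congr ?_ ?_
    · rfl
    · rw [← MulEquiv.orderOf_eq Ψ g]; rfl
  have hE : Nat.card (K ≃ₗ[F] (Fin n → F)) = Nat.card (GL (Fin n) F) := by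
    rw [Nat.card_congr Ψ.toEquiv]
    let e0 : K ≃ₗ[F] (Fin n → F) := LinearEquiv.ofFinrankEq _ _ (hK.trans hV.symm)
    exact Nat.card_congr
      { toFun := fun e => e0.symm ≪≫ₗ e
        invFun := fun f => e0 ≪≫ₗ f
        left_inv := fun e => by ext; simp
        right_inv := fun f => by ext; simp }
  have hU : Nat.card Kˣ = q ^ n - 1 := by rw [Nat.card_units, hcK]
  have hNd : N ∣ q ^ n - 1 := Nat.div_dvd_of_dvd (by simpa using Nat.sub_dvd_pow_sub_pow q 1 n)
  have hT : Nat.card {x : Kˣ // orderOf x = N} = Nat.totient N := by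
    classical
    have := Fintype.ofFinite Kˣ
    rw [Nat.card_eq_fintype_card, Fintype.card_subtype]
    exact IsCyclic.card_orderOf_eq_totient (by rw [← Nat.card_eq_fintype_card, hU]; exact hNd)
  rw [hE, hT, ← hS, hcV, hK] at main
  have h1 : 1 < q ^ n := Nat.one_lt_pow hn.ne' hq2
  have h1' : (1 : ℚ) < (q : ℚ) ^ n := by exact_mod_cast h1
  have hn' : (0 : ℚ) < n := by exact_mod_cast hn
  rw [eq_div_iff (by have := mul_pos hn' (sub_pos.2 h1'); exact this.ne')]
  have mainQ := congrArg (Nat.cast : ℕ → ℚ) main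
  push_cast [Nat.cast_sub h1.le] at mainQ
  rw [mainQ]
  ring
end
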